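/- Let S be a nonabelian finite simple group with mccl(S) ≤ 23. Then S is isomorphic to the alternating group Alt(5) of degree 5. -/

import Mathlib

/-- `mccl G` is the maximum conjugacy class length of `G`. -/
noncomputable def mccl (G : Type*) [Group G] : ℕ :=
  ⨆ g : G, Nat.card (MulAction.orbit (ConjAct G) g)

lemma mccl_bound {G : Type*} [Group G] [Finite G] {n : ℕ} (h : mccl G ≤ n) (g : G) :
    (Subgroup.centralizer {g}).index ≤ n := by
  have h1 : Nat.card (MulAction.orbit (ConjAct G) g) ≤ mccl G :=
    le_ciSup (f := fun g : G => Nat.card (MulAction.orbit (ConjAct G) g))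
      (Set.finite_range _).bddAbove g
  have h2 : (Subgroup.centralizer {g}).index = Nat.card (MulAction.orbit (ConjAct G) g) := by
    rw [Nat.card_coe_set_eq, ← MulAction.index_stabilizer, ConjAct.stabilizer_eq_centralizer]
    rfl
  omega

lemma Subgroup.eq_top_of_sylow_le {M : Type*} [Group M] [Finite M] (H : Subgroup M)
    (h : ∀ q : ℕ, q.Prime → ∃ Q : Sylow q M, (Q : Subgroup M) ≤ H) : H = ⊤ := by
  rw [← Subgroup.index_eq_one]
  by_contra hne
  obtain ⟨q, hq, hd⟩ := Nat.exists_prime_and_dvd hne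
  obtain ⟨Q, hQ⟩ := h q hq
  have := Fact.mk hq
  exact Q.not_dvd_index (hd.trans (Subgroup.index_dvd_of_le hQ))

lemma IsPGroup.orderOf_coprime_of_mem {M : Type*} [Group M] {p q : ℕ} (hp : p.Prime)
    (hq : q.Prime) (hne : q ≠ p) {Q : Subgroup M} (hQ : IsPGroup q Q) {u : M} (hu : u ∈ Q) :
    (orderOf u).Coprime p := by
  have := hQ.orderOf_coprime (n := p) ((Nat.coprime_primes hq hp).2 hne) ⟨u, hu⟩
  simpa using this

lemma Sylow.normal_of_coprime_commute {M : Type*} [Group M] [Finite M] {p : ℕ} (hp : p.Prime)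
    (P : Sylow p M) (h : ∀ u : M, (orderOf u).Coprime p → ∀ g ∈ P, u * g = g * u) :
    (P : Subgroup M).Normal := by
  rw [← Subgroup.normalizer_eq_top_iff]
  apply Subgroup.eq_top_of_sylow_le
  intro q hq
  by_cases hqp : q = p
  · subst hqp
    exact ⟨P, Subgroup.le_normalizer⟩
  · obtain ⟨Q⟩ : Nonempty (Sylow q M) := inferInstance
    refine ⟨Q, fun u hu => Subgroup.centralizer_le_normalizer _ ?_⟩
    rw [Subgroup.mem_centralizer_iff]
    exact fun g hg => (h u (Q.2.orderOf_coprime_of_mem hp hq hqp hu) g hg).symm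

lemma Sylow.mem_of_mem_normalizer {G : Type*} [Group G] [Finite G] {p : ℕ} [Fact p.Prime]
    (P : Sylow p G) {y : G} (hy : ∃ k, orderOf y = p ^ k)
    (hn : y ∈ Subgroup.normalizer (P : Set G)) : y ∈ P := by
  obtain ⟨k, hk⟩ := hy
  have h1 : IsPGroup p (Subgroup.zpowers y) := IsPGroup.of_card (n := k) (by simpa using hk)
  have h2 := h1.inf_normalizer_sylow P
  have h3 : y ∈ Subgroup.zpowers y ⊓ Subgroup.normalizer (P : Set G) :=
    ⟨Subgroup.mem_zpowers y, hn⟩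
  rw [h2] at h3
  exact h3.2

lemma Subgroup.mem_centralizer_singleton {G : Type*} [Group G] {g x : G} :
    g ∈ Subgroup.centralizer {x} ↔ g * x = x * g := by
  rw [Subgroup.mem_centralizer_iff]
  simp [eq_comm]

lemma centralizer_mul_of_coprime {G : Type*} [Group G] [Finite G] {z u : G} (hc : z * u = u * z)
    (ho : (orderOf z).Coprime (orderOf u)) :
    Subgroup.centralizer {z * u} = Subgroup.centralizer {u} ⊓ Subgroup.centralizer {z} := by
  ext g
  simp only [Subgroup.mem_inf, Subgroup.mem_centralizer_singleton]
  constructor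
  · intro h
    have hcomm : Commute z u := hc
    have hg : Commute g (z * u) := h
    have key : ∀ a b : G, Commute a b → (orderOf a).Coprime (orderOf b) → Commute g (a * b) →
        Commute g b := by
      intro a b hab hco hgab
      have h1 : Commute g (b ^ orderOf a) := by
        have := hgab.pow_right (orderOf a)
        rwa [hab.mul_pow, pow_orderOf_eq_one, one_mul] at this
      obtain ⟨m, hm⟩ := exists_pow_eq_self_of_coprime (n := orderOf a) (x := b) hco
      rw [← hm]
      exact h1.pow_right m
    exact ⟨key z u hcomm ho hg, key u z hcomm.symm ho.symm (hcomm.eq ▸ hg)⟩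
  · rintro ⟨h1, h2⟩
    exact (Commute.mul_right (show Commute g z from h2) (show Commute g u from h1)).eq

lemma relIndex_centralizer_mul_le {G : Type*} [Group G] [Finite G] {n : ℕ}
    (hb : ∀ g : G, (Subgroup.centralizer {g}).index ≤ n) {z u : G} (hc : z * u = u * z)
    (ho : (orderOf z).Coprime (orderOf u)) :
    (Subgroup.centralizer {u}).relIndex (Subgroup.centralizer {z}) *
      (Subgroup.centralizer {z}).index ≤ n := by
  have h := hb (z * u)
  rwa [centralizer_mul_of_coprime hc ho, ← Subgroup.relIndex_mul_index inf_le_right,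
    Subgroup.inf_relIndex_right] at h

section Simple

variable {G : Type*} [Group G] [IsSimpleGroup G]

lemma center_eq_bot_of_simple (hna : ¬ ∀ a b : G, a * b = b * a) : Subgroup.center G = ⊥ := by
  refine (IsSimpleGroup.eq_bot_or_eq_top_of_normal (Subgroup.center G) inferInstance).resolve_right
    fun h => hna fun a b => ?_
  have : b ∈ Subgroup.center G := h ▸ Subgroup.mem_top b
  exact Subgroup.mem_center_iff.1 this a

lemma centralizer_ne_top (hna : ¬ ∀ a b : G, a * b = b * a) {x : G} (hx : x ≠ 1) :
    Subgroup.centralizer {x} ≠ ⊤ := by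
  intro h
  apply hx
  rw [← Subgroup.mem_bot, ← center_eq_bot_of_simple hna, Subgroup.mem_center_iff]
  intro g
  exact Subgroup.mem_centralizer_singleton.1 (h ▸ Subgroup.mem_top g)

lemma eq_one_of_smul_eq {α : Type*} [MulAction G α] {g₀ : G} {a₀ : α} (h0 : g₀ • a₀ ≠ a₀) {g : G}
    (hg : ∀ a : α, g • a = a) : g = 1 := by
  have h1 : g ∈ (MulAction.toPermHom G α).ker := by
    rw [MonoidHom.mem_ker]
    ext a
    exact hg a
  rcases IsSimpleGroup.eq_bot_or_eq_top_of_normal (MulAction.toPermHom G α).ker inferInstance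
    with h | h
  · rw [h] at h1
    exact h1
  · exfalso
    have h2 : g₀ ∈ (MulAction.toPermHom G α).ker := h ▸ Subgroup.mem_top _
    rw [MonoidHom.mem_ker] at h2
    exact h0 (by simpa using congrArg (fun σ => σ a₀) h2)

lemma eq_one_of_smul_quotient_eq {H : Subgroup G} (hH : H ≠ ⊤) {g : G}
    (hg : ∀ a : G ⧸ H, g • a = a) : g = 1 := by
  obtain ⟨g₀, h0⟩ : ∃ g₀, g₀ ∉ H := by
    by_contra! hcon
    exact hH (by ext; simp [hcon])
  refine eq_one_of_smul_eq (g₀ := g₀) (a₀ := ((1 : G) : G ⧸ H)) (fun h => h0 ?_) hg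
  rw [MulAction.Quotient.smul_coe, QuotientGroup.eq] at h
  simpa using h

variable [Finite G]

lemma exists_injective_alternatingGroup (hna : ¬ ∀ a b : G, a * b = b * a) {H : Subgroup G}
    (hH : H ≠ ⊤) : ∃ f : G →* alternatingGroup (Fin H.index), Function.Injective f := by
  classical
  have e : (G ⧸ H) ≃ Fin H.index := Finite.equivFin _
  let f₁ : G →* Equiv.Perm (Fin H.index) :=
    (e.permCongrHom : Equiv.Perm (G ⧸ H) ≃* _).toMonoidHom.comp (MulAction.toPermHom G (G ⧸ H))
  have hf₁ : Function.Injective f₁ := by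
    have : Function.Injective (MulAction.toPermHom G (G ⧸ H)) := by
      rw [injective_iff_map_eq_one]
      intro g hg
      exact eq_one_of_smul_quotient_eq hH fun a => by
        simpa using congrArg (fun σ => σ a) hg
    exact e.permCongrHom.injective.comp this
  let s : G →* ℤˣ := Equiv.Perm.sign.comp f₁
  have hs : s.ker = ⊤ := by
    refine (IsSimpleGroup.eq_bot_or_eq_top_of_normal s.ker inferInstance).resolve_left fun h => ?_
    rw [MonoidHom.ker_eq_bot_iff] at h
    exact hna fun a b => h (by rw [map_mul, map_mul, mul_comm])
  refine ⟨f₁.codRestrict _ fun g => ?_, fun a b hab => hf₁ (congrArg Subtype.val hab)⟩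
  have : g ∈ s.ker := hs ▸ Subgroup.mem_top g
  exact Equiv.Perm.mem_alternatingGroup.2 this

lemma two_mul_card_dvd_factorial_index (hna : ¬ ∀ a b : G, a * b = b * a) {H : Subgroup G}
    (hH : H ≠ ⊤) : 2 * Nat.card G ∣ H.index.factorial := by
  obtain ⟨f, hf⟩ := exists_injective_alternatingGroup hna hH
  have h1 : H.index ≠ 1 := by rwa [Ne, Subgroup.index_eq_one]
  have h0 : H.index ≠ 0 := H.index_ne_zero_of_finite
  have : Nontrivial (Fin H.index) := Fin.nontrivial_iff_two_le.2 (by omega)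
  have h2 := two_mul_nat_card_alternatingGroup (α := Fin H.index)
  rw [Nat.card_perm, Nat.card_fin] at h2
  rw [← h2]
  exact Nat.mul_dvd_mul_left 2 (Subgroup.card_dvd_of_injective f hf)

lemma Sylow.ne_top_of_simple (hna : ¬ ∀ a b : G, a * b = b * a) {p : ℕ} [Fact p.Prime]
    (P : Sylow p G) : (P : Subgroup G) ≠ ⊤ := by
  intro h
  have h1 : IsPGroup p G := by
    have := P.2
    rw [h] at this
    exact this.of_equiv Subgroup.topEquiv
  have := h1.bot_lt_center
  rw [center_eq_bot_of_simple hna] at this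
  exact lt_irrefl _ this

lemma Sylow.eq_bot_of_normalizer_le_centralizer (hna : ¬ ∀ a b : G, a * b = b * a) {p : ℕ}
    [Fact p.Prime] (P : Sylow p G)
    (h : Subgroup.normalizer (P : Set G) ≤ Subgroup.centralizer (P : Set G)) :
    (P : Subgroup G) = ⊥ := by
  have hc := MonoidHom.ker_transferSylow_isComplement' P h
  rcases IsSimpleGroup.eq_bot_or_eq_top_of_normal _
    (inferInstance : (MonoidHom.transferSylow P h).ker.Normal) with hk | hk
  · rw [hk, Subgroup.isComplement'_bot_left] at hc
    exact absurd hc (P.ne_top_of_simple hna)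
  · rwa [hk, Subgroup.isComplement'_top_left] at hc

lemma Sylow.normalizer_ne_top_of_simple (hna : ¬ ∀ a b : G, a * b = b * a) {p : ℕ}
    [Fact p.Prime] (P : Sylow p G) (hP : (P : Subgroup G) ≠ ⊥) :
    Subgroup.normalizer (P : Set G) ≠ ⊤ := by
  intro h
  have hn : (P : Subgroup G).Normal := Subgroup.normalizer_eq_top_iff.1 h
  exact (IsSimpleGroup.eq_bot_or_eq_top_of_normal _ hn).elim hP (P.ne_top_of_simple hna)

omit [IsSimpleGroup G] in
lemma IsPGroup.index_stabilizer_eq_one_or_prime {p : ℕ} [hp : Fact p.Prime] (hG : IsPGroup p G)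
    {α : Type*} [MulAction G α] [Finite α] (hα : Nat.card α < p ^ 2) (a : α) :
    (MulAction.stabilizer G a).index = 1 ∨ (MulAction.stabilizer G a).index = p := by
  obtain ⟨n, hn⟩ := hG.index (MulAction.stabilizer G a)
  have h1 : (MulAction.stabilizer G a).index ≤ Nat.card α := by
    rw [MulAction.index_stabilizer]
    exact Set.ncard_le_card _
  have h2 : n < 2 := (Nat.pow_lt_pow_iff_right hp.out.one_lt).1 (by omega : p ^ n < p ^ 2)
  interval_cases n <;> simp_all

omit [IsSimpleGroup G] in
lemma IsPGroup.normal_of_index_eq_prime {p : ℕ} [hp : Fact p.Prime] (hG : IsPGroup p G)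
    {K : Subgroup G} (hK : K.index = p) : K.Normal := by
  apply Subgroup.normal_of_index_eq_minFac_card
  obtain ⟨n, hn⟩ := IsPGroup.iff_card.1 hG
  have hn0 : n ≠ 0 := by
    rintro rfl
    have := K.index_dvd_card
    rw [hn, hK] at this
    exact hp.out.one_lt.ne' (Nat.dvd_one.1 (by simpa using this))
  rw [hK, hn, hp.out.pow_minFac hn0]

omit [IsSimpleGroup G] in
lemma IsPGroup.exists_mem_center_of_normal {p : ℕ} [hp : Fact p.Prime] (hG : IsPGroup p G)
    {K : Subgroup G} (hK : K.Normal) (hne : K ≠ ⊥) :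
    ∃ z ∈ K, z ≠ 1 ∧ z ∈ Subgroup.center G := by
  have hG' : IsPGroup p (ConjAct G) := hG.of_equiv ConjAct.toConjAct
  have hd : p ∣ Nat.card K :=
    ((hG.to_subgroup K).card_eq_or_dvd).resolve_left fun h => hne (Subgroup.card_eq_one.1 h)
  obtain ⟨z, hz, hz1⟩ := hG'.exists_fixed_point_of_prime_dvd_card_of_fixed_point K hd
    (a := (1 : K)) (fun g => smul_one g)
  refine ⟨z, z.2, fun h => hz1 (Subtype.ext h.symm), ?_⟩
  rw [Subgroup.mem_center_iff]
  intro g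
  have h1 := congrArg Subtype.val (hz (ConjAct.toConjAct g))
  rw [ConjAct.Subgroup.val_conj_smul, ConjAct.toConjAct_smul] at h1
  exact mul_inv_eq_iff_eq_mul.1 h1

omit [IsSimpleGroup G] in
lemma IsPGroup.exists_le_centralizer {p : ℕ} [hp : Fact p.Prime] {P : Subgroup G}
    (hP : IsPGroup p P) (hne : P ≠ ⊥) : ∃ x ∈ P, x ≠ 1 ∧ P ≤ Subgroup.centralizer {x} := by
  have : Nontrivial P := (Subgroup.nontrivial_iff_ne_bot P).2 hne
  obtain ⟨z, -, hz1, hzc⟩ := hP.exists_mem_center_of_normal (K := ⊤) inferInstance top_ne_bot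
  refine ⟨z, z.2, fun h => hz1 (Subtype.ext h), fun u hu => ?_⟩
  rw [Subgroup.mem_centralizer_singleton]
  exact congrArg Subtype.val (Subgroup.mem_center_iff.1 hzc ⟨u, hu⟩)

lemma two_mul_prime_lt_index {p : ℕ} [hp : Fact p.Prime] {P : Subgroup G} (hP : IsPGroup p P)
    (hPc : p < Nat.card P) {H : Subgroup G} (hH : H ≠ ⊤) (hPH : P ≤ H) (hlt : H.index < p ^ 2) :
    2 * p < H.index := by
  have hmove : ∀ k : P, k ≠ 1 → ∃ d : G ⧸ H, k • d ≠ d := by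
    intro k hk
    by_contra! hcon
    exact hk (Subtype.ext (eq_one_of_smul_quotient_eq hH fun a => hcon a))
  have hcases := hP.index_stabilizer_eq_one_or_prime (α := G ⧸ H) hlt
  have hnt : Nontrivial P := Finite.one_lt_card_iff_nontrivial.1 (hp.out.one_lt.trans hPc)
  obtain ⟨u, hu⟩ := exists_ne (1 : P)
  obtain ⟨d₁, hd₁⟩ := hmove u hu
  have hi : ∀ (u : P) (d : G ⧸ H), u • d ≠ d → (MulAction.stabilizer P d).index = p := by
    intro u d hd
    refine (hcases d).resolve_left fun h => hd ?_
    rw [Subgroup.index_eq_one] at h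
    exact MulAction.mem_stabilizer_iff.1 (h ▸ Subgroup.mem_top u)
  have hi₁ := hi u d₁ hd₁
  have hKn := hP.normal_of_index_eq_prime hi₁
  have hK : MulAction.stabilizer P d₁ ≠ ⊥ := by
    intro h
    rw [h, Subgroup.index_bot] at hi₁
    omega
  obtain ⟨⟨k, hk⟩, hk1'⟩ := Subgroup.ne_bot_iff_exists_ne_one.1 hK
  have hk1 : k ≠ 1 := fun h => hk1' (Subtype.ext h)
  obtain ⟨d₂, hd₂⟩ := hmove k hk1
  have hi₂ := hi k d₂ hd₂
  have hfix : ∀ d ∈ MulAction.orbit P d₁, k • d = d := by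
    rintro _ ⟨v, rfl⟩
    have h1 := hKn.conj_mem k hk v⁻¹
    rw [MulAction.mem_stabilizer_iff, inv_inv, mul_smul, mul_smul, inv_smul_eq_iff] at h1
    exact h1
  have h0 : ∀ u : P, u • ((1 : G) : G ⧸ H) = ((1 : G) : G ⧸ H) := by
    intro u
    change ((u : G) • ((1 : G) : G ⧸ H)) = _
    rw [MulAction.Quotient.smul_coe, QuotientGroup.eq]
    simpa using hPH u.2
  have hn : ∀ (u : P) (d : G ⧸ H), u • d ≠ d → ((1 : G) : G ⧸ H) ∉ MulAction.orbit P d := by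
    rintro u d hd ⟨v, hv⟩
    have h2 : d = ((1 : G) : G ⧸ H) := by
      rw [← h0 v⁻¹, ← hv]
      simp
    exact hd (h2 ▸ h0 u)
  have hdisj : Disjoint (MulAction.orbit P d₁) (MulAction.orbit P d₂) := by
    rw [Set.disjoint_left]
    intro d h1 h2
    have h3 : d₂ ∈ MulAction.orbit P d := MulAction.mem_orbit_symm.1 h2
    rw [MulAction.orbit_eq_iff.2 h1] at h3
    exact hd₂ (hfix d₂ h3)
  rw [MulAction.index_stabilizer] at hi₁ hi₂
  have h3 : (insert ((1 : G) : G ⧸ H) (MulAction.orbit P d₁ ∪ MulAction.orbit P d₂)).ncard =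
      2 * p + 1 := by
    rw [Set.ncard_insert_of_notMem, Set.ncard_union_eq hdisj, hi₁, hi₂, two_mul]
    rintro (h | h)
    exacts [hn u d₁ hd₁ h, hn k d₂ hd₂ h]
  have h4 : _ ≤ Nat.card (G ⧸ H) := Set.ncard_le_card
    (insert ((1 : G) : G ⧸ H) (MulAction.orbit P d₁ ∪ MulAction.orbit P d₂))
  rw [h3] at h4
  exact h4

omit [IsSimpleGroup G] [Finite G] in
lemma Sylow.prime_dvd_card_of_ne_bot {p : ℕ} [hp : Fact p.Prime] (P : Sylow p G)
    (hP : (P : Subgroup G) ≠ ⊥) : p ∣ Nat.card P :=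
  (P.2.card_eq_or_dvd).resolve_left fun h => hP (Subgroup.card_eq_one.1 h)

omit [IsSimpleGroup G] [Finite G] in
lemma IsPGroup.orderOf_mem_eq_pow {p : ℕ} [hp : Fact p.Prime] {P : Subgroup G}
    (hP : IsPGroup p P) {x : G} (hx : x ∈ P) : ∃ k, orderOf x = p ^ k := by
  obtain ⟨k, hk⟩ := IsPGroup.iff_orderOf.1 hP ⟨x, hx⟩
  exact ⟨k, by simpa using hk⟩

omit [Finite G] in
lemma exists_conj_notMem {P : Subgroup G} (hP : P ≠ ⊤) {x : G} (hx : x ≠ 1) :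
    ∃ g : G, g * x * g⁻¹ ∉ P := by
  by_contra! hcon
  have h1 : Subgroup.normalClosure {x} ≤ P := by
    rw [Subgroup.normalClosure, Subgroup.closure_le]
    intro y hy
    obtain ⟨a, ha, hay⟩ := Group.mem_conjugatesOfSet_iff.1 hy
    rw [Set.mem_singleton_iff.1 ha, isConj_iff] at hay
    obtain ⟨c, rfl⟩ := hay
    exact hcon c
  have hxm : x ∈ Subgroup.normalClosure {x} := Subgroup.subset_normalClosure rfl
  rcases IsSimpleGroup.eq_bot_or_eq_top_of_normal (Subgroup.normalClosure {x}) inferInstance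
    with h | h
  · rw [h] at hxm
    exact hx hxm
  · exact hP (top_le_iff.1 (h ▸ h1))

lemma Sylow.card_eq_prime_of_large (hna : ¬ ∀ a b : G, a * b = b * a)
    (hb : ∀ g : G, (Subgroup.centralizer {g}).index ≤ 23) {p : ℕ} [hp : Fact p.Prime]
    (hp5 : 5 ≤ p) (h11 : p = 5 → ¬ 11 ∣ Nat.card G) (P : Sylow p G)
    (hP : (P : Subgroup G) ≠ ⊥) : Nat.card P = p := by
  by_contra hne
  have hlt : p < Nat.card P :=
    lt_of_le_of_ne (Nat.le_of_dvd Nat.card_pos (P.prime_dvd_card_of_ne_bot hP)) (Ne.symm hne)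
  have hsq : 23 < p ^ 2 := by nlinarith
  have hbig : ∀ z : G, z ≠ 1 → (P : Subgroup G) ≤ Subgroup.centralizer {z} →
      12 ≤ (Subgroup.centralizer {z}).index := by
    intro z hz hPz
    have h1 := two_mul_prime_lt_index P.2 hlt (centralizer_ne_top hna hz) hPz
      ((hb z).trans_lt hsq)
    have h2 := (Subgroup.centralizer {z}).index_dvd_card
    by_contra hcon
    have h3 : p = 5 := by omega
    have h4 : (Subgroup.centralizer {z}).index = 11 := by omega
    exact h11 h3 (h4 ▸ h2)
  obtain ⟨x, hxP, hx1, hPx⟩ := P.2.exists_le_centralizer hP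
  obtain ⟨g, hg⟩ := exists_conj_notMem (P.ne_top_of_simple hna) hx1
  set y := g * x * g⁻¹ with hy
  have hyo : ∃ k, orderOf y = p ^ k := by
    obtain ⟨k, hk⟩ := P.2.orderOf_mem_eq_pow hxP
    refine ⟨k, ?_⟩
    rw [← hk, hy, ← MulAut.conj_apply, MulEquiv.orderOf_eq]
  have hstab : ∀ u : P, u ∈ MulAction.stabilizer P (g : G ⧸ Subgroup.centralizer {x}) ↔
      (u : G) * y = y * u := by
    intro u
    rw [← Subgroup.inv_mem_iff]
    change (u : G)⁻¹ • (g : G ⧸ Subgroup.centralizer {x}) = _ ↔ _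
    rw [MulAction.Quotient.smul_coe, QuotientGroup.eq, Subgroup.mem_centralizer_singleton, hy]
    simp only [smul_eq_mul, mul_inv_rev, inv_inv]
    constructor <;> intro h
    · calc (u : G) * (g * x * g⁻¹) = g * (g⁻¹ * u * g * x) * g⁻¹ := by group
        _ = g * (x * (g⁻¹ * u * g)) * g⁻¹ := by rw [h]
        _ = g * x * g⁻¹ * u := by group
    · calc g⁻¹ * u * g * x = g⁻¹ * (u * (g * x * g⁻¹)) * g := by group
        _ = g⁻¹ * (g * x * g⁻¹ * u) * g := by rw [h]
        _ = x * (g⁻¹ * u * g) := by group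
  have hi : (MulAction.stabilizer P (g : G ⧸ Subgroup.centralizer {x})).index = p := by
    refine (P.2.index_stabilizer_eq_one_or_prime ((hb x).trans_lt hsq) _).resolve_left fun h => ?_
    rw [Subgroup.index_eq_one] at h
    refine hg (P.mem_of_mem_normalizer hyo ?_)
    have hc : y ∈ Subgroup.centralizer (P : Set G) := by
      rw [Subgroup.mem_centralizer_iff]
      intro u hu
      exact (hstab ⟨u, hu⟩).1 (h ▸ Subgroup.mem_top _)
    exact Subgroup.centralizer_le_normalizer _ hc
  have hK : MulAction.stabilizer P (g : G ⧸ Subgroup.centralizer {x}) ≠ ⊥ := by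
    intro h
    rw [h, Subgroup.index_bot] at hi
    exact hne hi
  obtain ⟨z, hzK, hz1, hzc⟩ := P.2.exists_mem_center_of_normal (P.2.normal_of_index_eq_prime hi) hK
  have hz1' : (z : G) ≠ 1 := fun h => hz1 (Subtype.ext h)
  have hPz : (P : Subgroup G) ≤ Subgroup.centralizer {(z : G)} := by
    intro u hu
    rw [Subgroup.mem_centralizer_singleton]
    exact congrArg Subtype.val (Subgroup.mem_center_iff.1 hzc ⟨u, hu⟩)
  have hyz : y ∈ Subgroup.centralizer {(z : G)} :=
    Subgroup.mem_centralizer_singleton.2 ((hstab z).1 hzK).symm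
  have hn : ((P.subtype hPz : Sylow p _) : Subgroup (Subgroup.centralizer {(z : G)})).Normal := by
    refine Sylow.normal_of_coprime_commute hp.out _ fun u hu v _ => ?_
    have hco : (orderOf (z : G)).Coprime (orderOf (u : G)) := by
      obtain ⟨k, hk⟩ := P.2.orderOf_mem_eq_pow z.2
      rw [hk, Subgroup.orderOf_coe]
      exact hu.symm.pow_left k
    have h1 := relIndex_centralizer_mul_le hb
      (Subgroup.mem_centralizer_singleton.1 u.2).symm hco
    have h2 := hbig z hz1' hPz
    have h3 : (Subgroup.centralizer {(u : G)}).relIndex (Subgroup.centralizer {(z : G)}) ≠ 0 :=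
      Subgroup.index_ne_zero_of_finite
    have h4 : (Subgroup.centralizer {(u : G)}).relIndex (Subgroup.centralizer {(z : G)}) = 1 := by
      by_contra h5
      have h6 : 2 ≤ (Subgroup.centralizer {(u : G)}).relIndex (Subgroup.centralizer {(z : G)}) := by
        omega
      nlinarith
    have h5 := Subgroup.relIndex_eq_one.1 h4 v.2
    exact Subtype.ext (Subgroup.mem_centralizer_singleton.1 h5).symm
  have hle : Subgroup.centralizer {(z : G)} ≤ Subgroup.normalizer (P : Set G) :=
    (Subgroup.normal_subgroupOf_iff_le_normalizer hPz).1 hn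
  exact hg (P.mem_of_mem_normalizer hyo (hle hyz))

lemma Sylow.relIndex_dvd_and_ne_one (hna : ¬ ∀ a b : G, a * b = b * a) {p : ℕ}
    [hp : Fact p.Prime] (P : Sylow p G) (hP : Nat.card P = p) :
    (Subgroup.centralizer (P : Set G)).relIndex (Subgroup.normalizer (P : Set G)) ∣ p - 1 ∧
      (Subgroup.centralizer (P : Set G)).relIndex (Subgroup.normalizer (P : Set G)) ≠ 1 := by
  have hcyc : IsCyclic P := isCyclic_of_prime_card hP
  constructor
  · have h1 := Subgroup.card_dvd_of_injective _
      (QuotientGroup.kerLift_injective (P : Subgroup G).normalizerMonoidHom)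
    rw [Subgroup.normalizerMonoidHom_ker, ← Subgroup.index, ← Subgroup.relIndex,
      IsCyclic.card_mulAut, hP, Nat.totient_prime hp.out] at h1
    exact h1
  · intro h
    have hb := P.eq_bot_of_normalizer_le_centralizer hna (Subgroup.relIndex_eq_one.1 h)
    have h1 : Nat.card P = 1 := Subgroup.card_eq_one.2 hb
    exact hp.out.one_lt.ne' (hP.symm.trans h1)

omit [IsSimpleGroup G] in
lemma Sylow.index_centralizer_le
    (hb : ∀ g : G, (Subgroup.centralizer {g}).index ≤ 23) {p : ℕ}
    [hp : Fact p.Prime] (P : Sylow p G) (hP : Nat.card P = p) :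
    (Subgroup.centralizer (P : Set G)).index ≤ 23 := by
  have hcyc : IsCyclic P := isCyclic_of_prime_card hP
  obtain ⟨x, hx⟩ := hcyc.exists_generator
  have hle : Subgroup.centralizer {(x : G)} ≤ Subgroup.centralizer (P : Set G) := by
    intro g hg
    rw [Subgroup.mem_centralizer_iff]
    intro u hu
    obtain ⟨k, hk⟩ := Subgroup.mem_zpowers_iff.1 (hx ⟨u, hu⟩)
    have hk' : (x : G) ^ k = u := by simpa using congrArg Subtype.val hk
    rw [← hk']
    have hc : Commute g (x : G) := Subgroup.mem_centralizer_singleton.1 hg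
    exact (hc.zpow_right k).symm.eq
  exact (Nat.le_of_dvd (Nat.pos_of_ne_zero Subgroup.index_ne_zero_of_finite)
    (Subgroup.index_dvd_of_le hle)).trans (hb x)

lemma Sylow.exists_eq_mul (hna : ¬ ∀ a b : G, a * b = b * a)
    (hb : ∀ g : G, (Subgroup.centralizer {g}).index ≤ 23) {p : ℕ}
    [hp : Fact p.Prime] (P : Sylow p G) (hP : Nat.card P = p) :
    ∃ e k, e ∣ p - 1 ∧ e ≠ 0 ∧ e ≠ 1 ∧ k ≠ 0 ∧ Nat.card (Sylow p G) = k * p + 1 ∧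
      e * (k * p + 1) ≤ 23 ∧
      (Subgroup.centralizer (P : Set G)).index = e * (k * p + 1) := by
  obtain ⟨h1, h2⟩ := P.relIndex_dvd_and_ne_one hna hP
  have h3 := P.index_centralizer_le hb hP
  have h4 := Subgroup.relIndex_mul_index (Subgroup.centralizer_le_normalizer (P : Set G))
  have hn1 : (Subgroup.normalizer (P : Set G)).index ≠ 1 := by
    rw [Ne, Subgroup.index_eq_one]
    refine P.normalizer_ne_top_of_simple hna fun h => ?_
    have h1 : Nat.card P = 1 := Subgroup.card_eq_one.2 h
    exact hp.out.one_lt.ne' (hP.symm.trans h1)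
  have hmod := card_sylow_modEq_one p G
  rw [P.card_eq_index_normalizer] at hmod ⊢
  have hpos : (Subgroup.normalizer (P : Set G)).index ≠ 0 := Subgroup.index_ne_zero_of_finite
  obtain ⟨k, hk⟩ := (Nat.modEq_iff_dvd' (by omega)).1 hmod.symm
  have hk' : (Subgroup.normalizer (P : Set G)).index = k * p + 1 := by
    rw [mul_comm k p]; omega
  refine ⟨_, k, h1, Subgroup.index_ne_zero_of_finite, h2, ?_, hk', ?_, ?_⟩
  · rintro rfl
    simp at hk'
    exact hn1 (by rw [Subgroup.index_eq_one]; exact hk')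
  · rw [← hk', h4]; exact h3
  · rw [← hk', h4]

lemma Sylow.card_centralizer_eq {p : ℕ} [hp : Fact p.Prime] (P : Sylow p G) (hP : Nat.card P = p)
    (hn : Nat.card (Sylow p G) = p + 1) : Nat.card (Subgroup.centralizer (P : Set G)) = p := by
  have hcyc : IsCyclic P := isCyclic_of_prime_card hP
  have hPC : (P : Subgroup G) ≤ Subgroup.centralizer (P : Set G) := by
    intro u hu
    rw [Subgroup.mem_centralizer_iff]
    intro v hv
    let := hcyc.commGroup
    exact congrArg Subtype.val (mul_comm (⟨v, hv⟩ : P) ⟨u, hu⟩)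
  refine le_antisymm ?_ (hP.symm.le.trans (Subgroup.card_le_of_le hPC))
  obtain ⟨Q, hQ⟩ : ∃ Q : Sylow p G, Q ≠ P := by
    have : Nontrivial (Sylow p G) := by
      rw [← Finite.one_lt_card_iff_nontrivial, hn]
      have := hp.out.pos
      omega
    exact exists_ne P
  have hfix : ∀ u ∈ Subgroup.normalizer (P : Set G), u • P = P := fun u hu =>
    Sylow.smul_eq_iff_mem_normalizer.2 hu
  have hPfix : ∀ u : P, u • P = P := fun u => hfix u (Subgroup.le_normalizer u.2)
  have hQP : ∀ (C : Subgroup G), C ≤ Subgroup.normalizer (P : Set G) →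
      P ∉ MulAction.orbit C Q := by
    rintro C hC ⟨c, hc⟩
    have h1 : (c : G) • Q = P := hc
    have h2 : (c : G) • Q = (c : G) • P := h1.trans (hfix c (hC c.2)).symm
    exact hQ (smul_left_cancel _ h2)
  have hle : ∀ (C : Subgroup G), C ≤ Subgroup.normalizer (P : Set G) →
      (MulAction.orbit C Q).ncard ≤ p := by
    intro C hC
    have h1 := Set.ncard_le_card (insert P (MulAction.orbit C Q))
    rw [Set.ncard_insert_of_notMem (hQP C hC), hn] at h1
    omega
  have horb : (MulAction.orbit (P : Subgroup G) Q).ncard = p := by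
    have h1 : (MulAction.stabilizer (P : Subgroup G) Q).index ∣ p := by
      have := (MulAction.stabilizer (P : Subgroup G) Q).index_dvd_card
      rwa [hP] at this
    rw [← MulAction.index_stabilizer]
    refine ((Nat.dvd_prime hp.out).1 h1).resolve_left fun h => hQ ?_
    rw [Subgroup.index_eq_one] at h
    have h2 : (P : Subgroup G) ≤ Q := by
      intro u hu
      refine Q.mem_of_mem_normalizer (P.2.orderOf_mem_eq_pow hu) ?_
      rw [← Sylow.smul_eq_iff_mem_normalizer]
      have h3 : (⟨u, hu⟩ : (P : Subgroup G)) ∈ MulAction.stabilizer (P : Subgroup G) Q :=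
        h ▸ Subgroup.mem_top _
      exact MulAction.mem_stabilizer_iff.1 h3
    exact Sylow.ext (P.3 Q.2 h2)
  have huniv : insert P (MulAction.orbit (P : Subgroup G) Q) = Set.univ := by
    rw [Set.eq_univ_iff_ncard, Set.ncard_insert_of_notMem (hQP _ Subgroup.le_normalizer), horb, hn]
  have hstab : MulAction.stabilizer (Subgroup.centralizer (P : Set G)) Q = ⊥ := by
    rw [Subgroup.eq_bot_iff_forall]
    intro c hc
    have hcQ : (c : G) • Q = Q := hc
    obtain ⟨u, hu⟩ : ∃ u : P, u • Q ≠ Q := by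
      by_contra! hcon
      have h1 : MulAction.orbit (P : Subgroup G) Q ⊆ {Q} := by
        rintro _ ⟨u, rfl⟩
        exact hcon u
      have h2 := Set.ncard_le_ncard h1
      rw [horb, Set.ncard_singleton] at h2
      exact absurd hp.out.one_lt (by omega)
    refine Subtype.ext (eq_one_of_smul_eq (g₀ := (u : G)) (a₀ := Q) hu fun R => ?_)
    have hR : R ∈ insert P (MulAction.orbit (P : Subgroup G) Q) := huniv ▸ Set.mem_univ R
    rcases hR with rfl | ⟨v, rfl⟩
    · exact hfix c (Subgroup.centralizer_le_normalizer _ c.2)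
    · change (c : G) • (v : G) • Q = (v : G) • Q
      have h1 := Subgroup.mem_centralizer_iff.1 c.2 v v.2
      rw [← mul_smul, ← h1, mul_smul, hcQ]
  have h1 := hle _ (Subgroup.centralizer_le_normalizer (P : Set G))
  rwa [← MulAction.index_stabilizer, hstab, Subgroup.index_bot] at h1

lemma not_dvd_card_of_large (hna : ¬ ∀ a b : G, a * b = b * a)
    (hb : ∀ g : G, (Subgroup.centralizer {g}).index ≤ 23) {p : ℕ} (hp : p.Prime)
    (hp11 : 11 ≤ p) : ¬ p ∣ Nat.card G := by
  intro hd
  have := Fact.mk hp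
  obtain ⟨P⟩ : Nonempty (Sylow p G) := inferInstance
  have hP := P.card_eq_prime_of_large hna hb (by omega) (by omega) (P.ne_bot_of_dvd_card hd)
  obtain ⟨e, k, -, he0, he1, hk, -, hle, -⟩ := P.exists_eq_mul hna hb hP
  have h1 : 2 ≤ e := by omega
  have h2 : 1 * 11 ≤ k * p := Nat.mul_le_mul (by omega) hp11
  nlinarith

lemma card_eq_of_dvd (hna : ¬ ∀ a b : G, a * b = b * a)
    (hb : ∀ g : G, (Subgroup.centralizer {g}).index ≤ 23) {p : ℕ} (hp : p.Prime)
    (hp57 : p = 5 ∨ p = 7) (hd : p ∣ Nat.card G) : Nat.card G = p * (2 * (p + 1)) := by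
  have := Fact.mk hp
  obtain ⟨P⟩ : Nonempty (Sylow p G) := inferInstance
  have h11 := not_dvd_card_of_large hna hb (show Nat.Prime 11 by norm_num) le_rfl
  have hP := P.card_eq_prime_of_large hna hb (by omega) (fun _ => h11) (P.ne_bot_of_dvd_card hd)
  obtain ⟨e, k, hdvd, he0, he1, hk, hn, hle, hi⟩ := P.exists_eq_mul hna hb hP
  have hcard := (Subgroup.centralizer (P : Set G)).card_mul_index
  have hk1 : k = 1 ∧ e = 2 := by
    have he2 : 2 ≤ e := by omega
    have hk2 : k ≤ 2 := by rcases hp57 with rfl | rfl <;> nlinarith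
    have he3 : e ≤ 3 := by
      have : 1 * p ≤ k * p := Nat.mul_le_mul_right p (by omega)
      rcases hp57 with rfl | rfl <;> nlinarith
    rcases hp57 with rfl | rfl <;> interval_cases k <;> interval_cases e <;> simp_all
    exact h11 (hcard ▸ Dvd.dvd.mul_left (by norm_num) _)
  obtain ⟨rfl, rfl⟩ := hk1
  rw [one_mul] at hn hi
  rw [← hcard, hi, P.card_centralizer_eq hP hn]

omit [IsSimpleGroup G] in
lemma Sylow.exists_card_eq_pow {p : ℕ} [hp : Fact p.Prime] (P : Sylow p G) :
    ∃ a, Nat.card P = p ^ a ∧ p ^ a * (P : Subgroup G).index = Nat.card G := by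
  obtain ⟨a, ha⟩ := IsPGroup.iff_card.1 P.2
  exact ⟨a, ha, by rw [← (P : Subgroup G).card_mul_index, ← ha]⟩

lemma Sylow.two_mul_card_dvd_factorial (hna : ¬ ∀ a b : G, a * b = b * a) {p : ℕ}
    [hp : Fact p.Prime] (hd : p ∣ Nat.card G) :
    2 * Nat.card G ∣ (Nat.card (Sylow p G)).factorial := by
  obtain ⟨P⟩ : Nonempty (Sylow p G) := inferInstance
  rw [P.card_eq_index_normalizer]
  exact two_mul_card_dvd_factorial_index hna
    (P.normalizer_ne_top_of_simple hna (P.ne_bot_of_dvd_card hd))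

lemma Sylow.card_ne_index_of_comm (hna : ¬ ∀ a b : G, a * b = b * a) {p : ℕ}
    [hp : Fact p.Prime] (P : Sylow p G) (hP : (P : Subgroup G) ≠ ⊥) (hc : IsMulCommutative P) :
    Nat.card (Sylow p G) ≠ (P : Subgroup G).index := by
  intro h
  rw [P.card_eq_index_normalizer] at h
  have h1 := Subgroup.relIndex_mul_index (Subgroup.le_normalizer (H := (P : Subgroup G)))
  have h2 : (P : Subgroup G).relIndex (Subgroup.normalizer (P : Set G)) = 1 := by
    rw [← h] at h1
    exact Nat.eq_of_mul_eq_mul_right (Nat.pos_of_ne_zero Subgroup.index_ne_zero_of_finite)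
      (h1.trans (one_mul _).symm)
  refine hP (P.eq_bot_of_normalizer_le_centralizer hna
    ((Subgroup.relIndex_eq_one.1 h2).trans fun u hu => ?_))
  rw [Subgroup.mem_centralizer_iff]
  intro v hv
  exact congrArg Subtype.val (hc.is_comm.comm (⟨v, hv⟩ : P) ⟨u, hu⟩)

lemma card_ne_112 (hna : ¬ ∀ a b : G, a * b = b * a) : Nat.card G ≠ 112 := by
  intro h
  obtain ⟨P⟩ : Nonempty (Sylow 2 G) := inferInstance
  have h1 := Sylow.two_mul_card_dvd_factorial hna (p := 2) (G := G) (by rw [h]; norm_num)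
  have h2 := P.card_dvd_index
  have h3 := P.not_dvd_index
  have h4 : (P : Subgroup G).index ∣ 112 := h ▸ Subgroup.index_dvd_card _
  have h5 : (P : Subgroup G).index ∣ 7 := by
    refine Nat.Coprime.dvd_of_dvd_mul_left (m := 16) (Nat.Coprime.pow_right 4 ?_ : Nat.Coprime _ (2 ^ 4)) h4
    exact ((Nat.Prime.coprime_iff_not_dvd Nat.prime_two).2 h3).symm
  rw [h] at h1
  rcases (Nat.dvd_prime (by norm_num)).1 (h2.trans h5) with h6 | h6 <;> rw [h6] at h1 <;>
    revert h1 <;> decide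

lemma nonempty_mulEquiv_of_card_eq (hna : ¬ ∀ a b : G, a * b = b * a) (h : Nat.card G = 60) :
    Nonempty (G ≃* alternatingGroup (Fin 5)) := by
  obtain ⟨P⟩ : Nonempty (Sylow 2 G) := inferInstance
  have hd : 2 ∣ Nat.card G := by rw [h]; norm_num
  have h1 := Sylow.two_mul_card_dvd_factorial hna hd
  have h2 := P.card_dvd_index
  have h3 := P.not_dvd_index
  have h4 : (P : Subgroup G).index ∣ 60 := h ▸ Subgroup.index_dvd_card _
  have h5 : (P : Subgroup G).index ∣ 15 := by
    refine Nat.Coprime.dvd_of_dvd_mul_left (m := 4) (Nat.Coprime.pow_right 2 ?_ : Nat.Coprime _ (2 ^ 2)) h4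
    exact ((Nat.Prime.coprime_iff_not_dvd Nat.prime_two).2 h3).symm
  obtain ⟨a, ha, hai⟩ := P.exists_card_eq_pow
  have hi : (P : Subgroup G).index = 15 := by
    obtain ⟨c, hc⟩ := h5
    have hc4 : 4 * c = 2 ^ a := by
      refine Nat.eq_of_mul_eq_mul_right (Nat.pos_of_ne_zero Subgroup.index_ne_zero_of_finite :
        0 < (P : Subgroup G).index) ?_
      rw [hai, h, mul_assoc, mul_comm c, ← hc]; rfl
    have hcd : c ∣ 2 ^ a := Dvd.intro_left _ hc4
    obtain ⟨b, -, rfl⟩ := (Nat.dvd_prime_pow Nat.prime_two).1 hcd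
    rcases Nat.eq_zero_or_pos b with rfl | hb
    · omega
    · exfalso
      have h7 : 2 ∣ 15 := hc ▸ (dvd_pow_self 2 hb.ne').mul_left _
      revert h7
      decide
  have hP4 : Nat.card P = 2 ^ 2 := by
    have := (P : Subgroup G).card_mul_index
    rw [hi, h] at this
    change Nat.card P * 15 = 60 at this
    omega
  have hne := P.card_ne_index_of_comm hna (P.ne_bot_of_dvd_card hd)
    (IsPGroup.isMulCommutative_of_card_eq_prime_sq hP4)
  rw [hi] at h2 hne
  rw [h] at h1
  have h6 : Nat.card (Sylow 2 G) = 5 := by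
    have h7 : Nat.card (Sylow 2 G) ∈ Nat.divisors 15 := Nat.mem_divisors.2 ⟨h2, by norm_num⟩
    have h8 : Nat.divisors 15 = {1, 3, 5, 15} := by decide
    rw [h8] at h7
    simp only [Finset.mem_insert, Finset.mem_singleton] at h7
    rcases h7 with h7 | h7 | h7 | h7
    · exact absurd (h7 ▸ h1) (by decide)
    · exact absurd (h7 ▸ h1) (by decide)
    · exact h7
    · exact absurd h7 hne
  rw [P.card_eq_index_normalizer] at h6
  obtain ⟨f, hf⟩ := h6 ▸ exists_injective_alternatingGroup hna
    (P.normalizer_ne_top_of_simple hna (P.ne_bot_of_dvd_card hd))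
  have hcard : Nat.card G = Nat.card (alternatingGroup (Fin 5)) := by
    have h9 := two_mul_nat_card_alternatingGroup (α := Fin 5)
    rw [Nat.card_perm, Nat.card_fin, show Nat.factorial 5 = 120 from rfl] at h9
    omega
  exact ⟨MulEquiv.ofBijective f ((Nat.bijective_iff_injective_and_card f).2 ⟨hf, hcard⟩)⟩

lemma eq_bot_of_normal_of_index_eq_pow {q : ℕ} [hq : Fact q.Prime]
    (hna : ¬ ∀ a b : G, a * b = b * a) {M : Subgroup G} {k : ℕ} (hi : M.index = q ^ k)
    {T : Subgroup M} (hT : IsPGroup q T) (hTn : T.Normal) : T = ⊥ := by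
  obtain ⟨S, hTS⟩ := (hT.map M.subtype).exists_le_sylow
  have hco : M.index.Coprime (S : Subgroup G).index := by
    rw [hi]
    exact ((Nat.Prime.coprime_iff_not_dvd hq.out).2 S.not_dvd_index).pow_left k
  have hrel : M.index ∣ M.relIndex S := by
    refine hco.dvd_of_dvd_mul_right ?_
    rw [← Subgroup.inf_relIndex_right, Subgroup.relIndex_mul_index inf_le_right]
    exact Subgroup.index_dvd_of_le inf_le_left
  have hcov : ∀ g : G, ∃ s ∈ S, ∃ m ∈ M, g = s * m := by
    intro g
    have h1 : MulAction.orbit S ((1 : G) : G ⧸ M) = Set.univ := by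
      have hst : MulAction.stabilizer S ((1 : G) : G ⧸ M) = M.subgroupOf S := by
        ext s
        rw [Subgroup.mem_subgroupOf, ← inv_mem_iff (H := M), MulAction.mem_stabilizer_iff]
        change (((s : G) * 1 : G) : G ⧸ M) = _ ↔ _
        rw [QuotientGroup.eq, mul_one, mul_one]
      rw [Set.eq_univ_iff_ncard]
      refine le_antisymm (Set.ncard_le_card _) ?_
      rw [← MulAction.index_stabilizer, hst]
      exact Nat.le_of_dvd (Nat.pos_of_ne_zero Subgroup.index_ne_zero_of_finite) hrel
    have h2 : (g : G ⧸ M) ∈ MulAction.orbit S ((1 : G) : G ⧸ M) := h1 ▸ Set.mem_univ _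
    obtain ⟨s, hs⟩ := h2
    have h3 : (((s : G) * 1 : G) : G ⧸ M) = g := hs
    rw [mul_one, QuotientGroup.eq] at h3
    exact ⟨s, s.2, _, h3, by group⟩
  have hle : Subgroup.normalClosure (T.map M.subtype : Set G) ≤ S := by
    rw [Subgroup.normalClosure, Subgroup.closure_le]
    intro y hy
    obtain ⟨_, ⟨t, ht, rfl⟩, hty⟩ := Group.mem_conjugatesOfSet_iff.1 hy
    obtain ⟨c, rfl⟩ := isConj_iff.1 hty
    obtain ⟨s, hs, m, hm, rfl⟩ := hcov c
    have h1 : m * t * m⁻¹ ∈ T.map M.subtype := ⟨_, hTn.conj_mem t ht ⟨m, hm⟩, rfl⟩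
    have h2 : s * (m * t * m⁻¹) * s⁻¹ ∈ (S : Subgroup G) :=
      mul_mem (mul_mem hs (hTS h1)) (inv_mem hs)
    rw [SetLike.mem_coe]
    convert h2 using 1
    simp only [Subgroup.subtype_apply]
    group
  rcases IsSimpleGroup.eq_bot_or_eq_top_of_normal
    (Subgroup.normalClosure (T.map M.subtype : Set G)) inferInstance with h | h
  · exact (Subgroup.map_eq_bot_iff_of_injective T M.subtype_injective).1
      (le_bot_iff.1 (h ▸ Subgroup.le_normalClosure))
  · exact absurd (top_le_iff.1 (h ▸ hle)) (S.ne_top_of_simple hna)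

omit [IsSimpleGroup G] in
lemma commute_of_coprime_two (hb : ∀ g : G, (Subgroup.centralizer {g}).index ≤ 23) {z w g : G}
    (hz : 8 ≤ (Subgroup.centralizer {z}).index) (hw : z * w = w * z)
    (ho : (orderOf z).Coprime (orderOf w)) (hg : g * z = z * g) (hg2 : (orderOf g).Coprime 2) :
    g * w = w * g := by
  have h1 := relIndex_centralizer_mul_le hb hw ho
  have h2 : (Subgroup.centralizer {w}).relIndex (Subgroup.centralizer {z}) ≠ 0 :=
    Subgroup.index_ne_zero_of_finite
  have h3 : (Subgroup.centralizer {w}).relIndex (Subgroup.centralizer {z}) ≤ 2 := by nlinarith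
  have hgz : g ∈ Subgroup.centralizer {z} := Subgroup.mem_centralizer_singleton.2 hg
  have h4 : (Subgroup.centralizer {w}).relIndex (Subgroup.centralizer {z}) = 1 ∨
    (Subgroup.centralizer {w}).relIndex (Subgroup.centralizer {z}) = 2 := by omega
  rcases h4 with h4 | h4
  · exact Subgroup.mem_centralizer_singleton.1 (Subgroup.relIndex_eq_one.1 h4 hgz)
  · have h5 : g * g ∈ Subgroup.centralizer {w} :=
      Subgroup.mul_self_mem_of_index_two h4 ⟨g, hgz⟩
    obtain ⟨m, hm⟩ := exists_pow_eq_self_of_coprime hg2.symm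
    rw [← sq] at h5
    exact Subgroup.mem_centralizer_singleton.1 (hm ▸ pow_mem h5 m)

lemma Sylow.index_ne_one (hna : ¬ ∀ a b : G, a * b = b * a) {p : ℕ} [hp : Fact p.Prime]
    (P : Sylow p G) : (P : Subgroup G).index ≠ 1 := by
  rw [Ne, Subgroup.index_eq_one]
  exact P.ne_top_of_simple hna

omit [IsSimpleGroup G] in
lemma Sylow.exists_index_eq_pow {p q : ℕ} [hp : Fact p.Prime]
    (h : ∀ r : ℕ, r.Prime → r ∣ Nat.card G → r = p ∨ r = q) (P : Sylow p G) {i : ℕ}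
    (hi : i ∣ (P : Subgroup G).index) : ∃ k, i = q ^ k := by
  have h0 : i ≠ 0 := fun h0 => Subgroup.index_ne_zero_of_finite (Nat.eq_zero_of_zero_dvd (h0 ▸ hi))
  refine ⟨_, Nat.eq_prime_pow_of_unique_prime_dvd h0 fun {r} hr hri => ?_⟩
  refine (h r hr ((hri.trans hi).trans (Subgroup.index_dvd_card _))).resolve_left ?_
  rintro rfl
  exact P.not_dvd_index (hri.trans hi)

omit [IsSimpleGroup G] in
lemma exists_centralizer_index_eq_pow {p q : ℕ} [hp : Fact p.Prime]
    (h : ∀ r : ℕ, r.Prime → r ∣ Nat.card G → r = p ∨ r = q) (hd : p ∣ Nat.card G) :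
    ∃ u : G, ∃ k, (∃ j, orderOf u = p ^ j) ∧ u ≠ 1 ∧
      (Subgroup.centralizer {u}).index = q ^ k := by
  obtain ⟨P⟩ : Nonempty (Sylow p G) := inferInstance
  obtain ⟨u, huP, hu1, hPu⟩ := P.2.exists_le_centralizer (P.ne_bot_of_dvd_card hd)
  obtain ⟨k, hk⟩ := P.exists_index_eq_pow h (Subgroup.index_dvd_of_le hPu)
  exact ⟨u, k, P.2.orderOf_mem_eq_pow huP, hu1, hk⟩

lemma dvd_card_of_primes (hna : ¬ ∀ a b : G, a * b = b * a) {p q : ℕ}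
    [hp : Fact p.Prime] (h : ∀ r : ℕ, r.Prime → r ∣ Nat.card G → r = p ∨ r = q) :
    q ∣ Nat.card G := by
  obtain ⟨P⟩ : Nonempty (Sylow p G) := inferInstance
  obtain ⟨k, hk⟩ := P.exists_index_eq_pow h dvd_rfl
  have hk0 : k ≠ 0 := by
    rintro rfl
    exact P.index_ne_one hna hk
  exact ((dvd_pow_self q hk0).trans hk.symm.dvd).trans (Subgroup.index_dvd_card _)

lemma Sylow.card_three_eq_nine (hna : ¬ ∀ a b : G, a * b = b * a)
    (hb : ∀ g : G, (Subgroup.centralizer {g}).index ≤ 23)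
    (h : ∀ r : ℕ, r.Prime → r ∣ Nat.card G → r = 2 ∨ r = 3) (P : Sylow 3 G) :
    Nat.card P = 3 ^ 2 := by
  have hd2 : 2 ∣ Nat.card G := dvd_card_of_primes hna (p := 3) fun r hr hrd => (h r hr hrd).symm
  obtain ⟨u, k, ⟨j, hj⟩, hu1, hk⟩ :=
    exists_centralizer_index_eq_pow h hd2
  have hk2 : k = 2 := by
    have h1 := hb u
    have h2 := two_mul_card_dvd_factorial_index hna (centralizer_ne_top hna hu1)
    rw [hk] at h1 h2
    have hk3 : k < 3 := (Nat.pow_lt_pow_iff_right (by norm_num : 1 < 3)).1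
      (by omega : 3 ^ k < 3 ^ 3)
    obtain ⟨m, hm⟩ := hd2
    interval_cases k
    · have := Nat.le_of_dvd (by norm_num) h2
      have := Nat.card_pos (α := G)
      simp at *
    · obtain ⟨c, hc⟩ := h2
      have h3 : Nat.factorial (3 ^ 1) = 6 := rfl
      rw [h3, hm, mul_assoc, mul_assoc] at hc
      omega
    · rfl
  subst hk2
  obtain ⟨T⟩ : Nonempty (Sylow 3 (Subgroup.centralizer {u})) := inferInstance
  have hTn : (T : Subgroup (Subgroup.centralizer {u})).Normal := by
    refine ⟨fun t ht g => T.mem_of_mem_normalizer ?_ (Subgroup.centralizer_le_normalizer _ ?_)⟩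
    · obtain ⟨a, ha⟩ := T.2.orderOf_mem_eq_pow ht
      exact ⟨a, by rw [← ha, ← MulAut.conj_apply, MulEquiv.orderOf_eq]⟩
    · rw [Subgroup.mem_centralizer_iff]
      intro s hs
      obtain ⟨a, ha⟩ := T.2.orderOf_mem_eq_pow ht
      obtain ⟨b, hb'⟩ := T.2.orderOf_mem_eq_pow hs
      have ha' : orderOf ((g * t * g⁻¹ : Subgroup.centralizer {u}) : G) = 3 ^ a := by
        rw [Subgroup.orderOf_coe, ← ha, ← MulAut.conj_apply, MulEquiv.orderOf_eq]
      refine Subtype.ext (commute_of_coprime_two hb (z := u) (by rw [hk]; norm_num)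
        (Subgroup.mem_centralizer_singleton.1 (g * t * g⁻¹).2).symm ?_
        (Subgroup.mem_centralizer_singleton.1 s.2) ?_)
      · rw [hj, ha']
        exact Nat.Coprime.pow _ _ (by norm_num)
      · rw [Subgroup.orderOf_coe, hb']
        exact Nat.Coprime.pow_left _ (by norm_num)
  have hT := eq_bot_of_normal_of_index_eq_pow hna hk T.2 hTn
  have h3 : ¬ 3 ∣ Nat.card (Subgroup.centralizer {u}) := fun h3 => T.ne_bot_of_dvd_card h3 hT
  have h4 := (Subgroup.centralizer {u}).card_mul_index
  obtain ⟨a, ha, hai⟩ := P.exists_card_eq_pow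
  rw [hk, ← hai] at h4
  rw [ha]
  apply Nat.dvd_antisymm
  · refine Nat.Coprime.dvd_of_dvd_mul_left ?_ (Dvd.intro _ h4.symm)
    exact ((Nat.Prime.coprime_iff_not_dvd Nat.prime_three).2 h3).pow_left a
  · refine Nat.Coprime.dvd_of_dvd_mul_right ?_ (Dvd.intro_left _ h4)
    exact ((Nat.Prime.coprime_iff_not_dvd Nat.prime_three).2 P.not_dvd_index).pow_left 2

lemma false_of_primes_two_three (hna : ¬ ∀ a b : G, a * b = b * a)
    (hb : ∀ g : G, (Subgroup.centralizer {g}).index ≤ 23)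
    (h : ∀ r : ℕ, r.Prime → r ∣ Nat.card G → r = 2 ∨ r = 3) : False := by
  obtain ⟨P⟩ : Nonempty (Sylow 3 G) := inferInstance
  have hP := P.card_three_eq_nine hna hb h
  have h9 := (P : Subgroup G).card_mul_index
  change Nat.card P * _ = _ at h9
  rw [hP] at h9
  have h9d : 9 ∣ Nat.card G := Dvd.intro _ h9
  have hd3 : 3 ∣ Nat.card G := (by norm_num : 3 ∣ 9).trans h9d
  obtain ⟨v, k, ⟨j, hj⟩, hv1, hk⟩ :=
    exists_centralizer_index_eq_pow (fun r hr hrd => (h r hr hrd).symm) hd3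
  have hk34 : k = 3 ∨ k = 4 := by
    have h1 := hb v
    have h2 := (Nat.mul_dvd_mul_left 2 h9d).trans
      (two_mul_card_dvd_factorial_index hna (centralizer_ne_top hna hv1))
    rw [hk] at h1 h2
    have hk3 : k < 5 := (Nat.pow_lt_pow_iff_right (by norm_num : 1 < 2)).1
      (by omega : 2 ^ k < 2 ^ 5)
    interval_cases k
    · exact absurd h2 (by decide)
    · exact absurd h2 (by decide)
    · exact absurd h2 (by decide)
    · exact Or.inl rfl
    · exact Or.inr rfl
  obtain ⟨T⟩ : Nonempty (Sylow 2 (Subgroup.centralizer {v})) := inferInstance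
  have hTn : (T : Subgroup (Subgroup.centralizer {v})).Normal := by
    refine Sylow.normal_of_coprime_commute Nat.prime_two T fun g hg t ht => ?_
    obtain ⟨a, ha⟩ := T.2.orderOf_mem_eq_pow ht
    refine Subtype.ext (commute_of_coprime_two hb (z := v) ?_
      (Subgroup.mem_centralizer_singleton.1 t.2).symm ?_
      (Subgroup.mem_centralizer_singleton.1 g.2) ?_)
    · rw [hk]
      rcases hk34 with rfl | rfl <;> norm_num
    · rw [hj, Subgroup.orderOf_coe, ha]
      exact Nat.Coprime.pow _ _ (by norm_num)
    · rwa [Subgroup.orderOf_coe]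
  have hT := eq_bot_of_normal_of_index_eq_pow hna hk T.2 hTn
  have h2 : ¬ 2 ∣ Nat.card (Subgroup.centralizer {v}) := fun h2 => T.ne_bot_of_dvd_card h2 hT
  have h4 := (Subgroup.centralizer {v}).card_mul_index
  rw [hk, ← h9] at h4
  obtain ⟨l, hl⟩ := P.exists_index_eq_pow (fun r hr hrd => (h r hr hrd).symm) dvd_rfl
  have hi : (P : Subgroup G).index = 2 ^ k := by
    apply Nat.dvd_antisymm
    · rw [hl] at h4 ⊢
      refine Nat.Coprime.dvd_of_dvd_mul_left ?_ (Dvd.intro_left _ h4.symm)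
      exact ((Nat.Prime.coprime_iff_not_dvd Nat.prime_two).2 h2).pow_left l
    · refine Nat.Coprime.dvd_of_dvd_mul_left ?_ (Dvd.intro_left _ h4)
      exact Nat.Coprime.pow _ _ (by norm_num)
  have hne := P.card_ne_index_of_comm hna (P.ne_bot_of_dvd_card hd3)
    (IsPGroup.isMulCommutative_of_card_eq_prime_sq hP)
  have hdvd := P.card_dvd_index
  have hmod := card_sylow_modEq_one 3 G
  have hfac := (Nat.mul_dvd_mul_left 2 h9d).trans (Sylow.two_mul_card_dvd_factorial hna hd3)
  rw [hi] at hne hdvd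
  obtain ⟨m, hm, hm'⟩ := (Nat.dvd_prime_pow Nat.prime_two).1 hdvd
  rw [hm'] at hne hmod hfac
  have hm4 : m ≤ 4 := by omega
  interval_cases m
  · exact absurd hfac (by decide)
  · exact absurd hfac (by decide)
  · exact absurd hfac (by decide)
  · exact absurd hmod (by decide)
  · exact hne (by congr 1; omega)

end Simple

theorem stmt_19 (S : Type*) [Group S] [Finite S]
    (hsimple : IsSimpleGroup S) (hna : ¬ ∀ a b : S, a * b = b * a)
    (h : mccl S ≤ 23) :
    Nonempty (S ≃* alternatingGroup (Fin 5)) := by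
  have hb := mccl_bound h
  by_cases h5 : 5 ∣ Nat.card S
  · exact nonempty_mulEquiv_of_card_eq hna (card_eq_of_dvd hna hb Nat.prime_five (Or.inl rfl) h5)
  have h7 : ¬ 7 ∣ Nat.card S := fun h7 =>
    card_ne_112 hna (card_eq_of_dvd hna hb (by norm_num) (Or.inr rfl) h7)
  refine (false_of_primes_two_three hna hb fun r hr hrd => ?_).elim
  have hr11 : r < 11 := by
    by_contra! hcon
    exact not_dvd_card_of_large hna hb hr hcon hrd
  interval_cases r <;> first | omega | (revert hr; norm_num)
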